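/- Let r ≥ 2 and let A ⊆ V(H_r) with |A| = r + 2. Then A is (r+1)-independent (every connected component of the induced subgraph H_r[A] has at most r + 1 vertices) if and only if A = {v₁, …, v_r, x₁, x₂} or A = {v_{r+1}, …, v_{2r}, x₁, x₂}. In particular, the (r+1)-independence complex Ind_{r+1}(H_r) has exactly two faces of cardinality r + 2. -/

import Mathlib

/-- A set `A` of vertices is `s`-independent in `G` if every connected component of the
induced subgraph `G[A]` has at most `s` vertices. -/
def rIndep {V : Type*} (G : SimpleGraph V) (s : ℕ) (A : Set V) : Prop :=
  ∀ c : (G.induce A).ConnectedComponent, c.supp.ncard ≤ s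

/-- The graph `H_r` on vertices `v₁, …, v_{2r}` (coded as `Sum.inl i`) and `x₁, x₂`
(coded as `Sum.inr 0`, `Sum.inr 1`): the `vᵢ` are pairwise adjacent, `x₁` is adjacent
exactly to `v₁, …, v_r` and `x₂` exactly to `v_{r+1}, …, v_{2r}`. -/
def Hr (r : ℕ) : SimpleGraph (Fin (2 * r) ⊕ Fin 2) :=
  SimpleGraph.fromRel fun u v =>
    match u, v with
    | Sum.inl _, Sum.inl _ => True
    | Sum.inl i, Sum.inr x => (x = 0 ∧ (i : ℕ) < r) ∨ (x = 1 ∧ r ≤ (i : ℕ))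
    | Sum.inr _, Sum.inl _ => False
    | Sum.inr _, Sum.inr _ => False

/-- A set of `s + 1` vertices is `s`-independent iff it induces a disconnected subgraph. -/
theorem rIndep_iff_not_preconnected {V : Type*} (G : SimpleGraph V) {s : ℕ} {A : Finset V}
    (hA : A.card = s + 1) :
    rIndep G s (A : Set V) ↔ ¬ (G.induce (A : Set V)).Preconnected := by
  have huniv : (Set.univ : Set (A : Set V)).ncard = s + 1 := by
    rw [Set.ncard_univ, Nat.card_coe_set_eq, Set.ncard_coe_finset, hA]
  constructor
  · intro h hconn
    obtain ⟨a, ha⟩ : A.Nonempty := Finset.card_pos.mp (by omega)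
    have hsupp : ((G.induce (A : Set V)).connectedComponentMk ⟨a, ha⟩).supp = Set.univ := by
      ext b
      simpa [SimpleGraph.ConnectedComponent.mem_supp_iff] using hconn b ⟨a, ha⟩
    have := h ((G.induce (A : Set V)).connectedComponentMk ⟨a, ha⟩)
    rw [hsupp, huniv] at this
    omega
  · intro h c
    by_contra! hc
    have hsupp : c.supp = Set.univ :=
      Set.eq_of_subset_of_ncard_le (Set.subset_univ _) (by omega) (Set.toFinite _)
    refine h fun a b => ?_
    have ha : a ∈ c.supp := hsupp ▸ Set.mem_univ a
    have hb : b ∈ c.supp := hsupp ▸ Set.mem_univ b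
    rw [SimpleGraph.ConnectedComponent.mem_supp_iff] at ha hb
    exact SimpleGraph.ConnectedComponent.exact (ha.trans hb.symm)

theorem not_preconnected_induce_of_isolated {V : Type*} (G : SimpleGraph V) {A : Set V} {x y : V}
    (hx : x ∈ A) (hy : y ∈ A) (hxy : x ≠ y) (hiso : ∀ z ∈ A, ¬ G.Adj x z) :
    ¬ (G.induce A).Preconnected := by
  intro h
  obtain ⟨p⟩ := h ⟨x, hx⟩ ⟨y, hy⟩
  cases p with
  | nil => exact hxy rfl
  | cons hadj _ => exact hiso _ (Subtype.property _) hadj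

@[simp]
theorem Hr_adj_inl_inl {r : ℕ} (i j : Fin (2 * r)) :
    (Hr r).Adj (Sum.inl i) (Sum.inl j) ↔ i ≠ j := by
  simp [Hr]

@[simp]
theorem Hr_adj_inr_inl {r : ℕ} (x : Fin 2) (i : Fin (2 * r)) :
    (Hr r).Adj (Sum.inr x) (Sum.inl i) ↔ (x = 0 ∧ (i : ℕ) < r) ∨ (x = 1 ∧ r ≤ (i : ℕ)) := by
  simp [Hr]

@[simp]
theorem not_Hr_adj_inr_inr {r : ℕ} (x y : Fin 2) :
    ¬ (Hr r).Adj (Sum.inr x) (Sum.inr y) := by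
  simp [Hr]

/-- A vertex set of `H_r` containing some `vᵢ` and, with each `xⱼ`, a neighbour of `xⱼ`,
induces a connected subgraph. -/
theorem Hr_induce_preconnected {r : ℕ} {A : Set (Fin (2 * r) ⊕ Fin 2)} {i : Fin (2 * r)}
    (hi : Sum.inl i ∈ A)
    (hA : ∀ x, Sum.inr x ∈ A → ∃ j, Sum.inl j ∈ A ∧ (Hr r).Adj (Sum.inr x) (Sum.inl j)) :
    ((Hr r).induce A).Preconnected := by
  have hinl : ∀ j (hj : Sum.inl j ∈ A),
      ((Hr r).induce A).Reachable ⟨Sum.inl j, hj⟩ ⟨Sum.inl i, hi⟩ := by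
    intro j hj
    by_cases hji : j = i
    · subst hji
      exact SimpleGraph.Reachable.refl _
    · exact SimpleGraph.Adj.reachable (by simpa using hji)
  have hall : ∀ a : A, ((Hr r).induce A).Reachable a ⟨Sum.inl i, hi⟩ := by
    rintro ⟨j | x, ha⟩
    · exact hinl j ha
    · obtain ⟨j, hj, hadj⟩ := hA x ha
      have hadj' : ((Hr r).induce A).Adj ⟨Sum.inr x, ha⟩ ⟨Sum.inl j, hj⟩ := hadj
      exact hadj'.reachable.trans (hinl j hj)
  exact fun a b => (hall a).trans (hall b).symm

theorem card_image_inl_union_pair_le {r : ℕ} {S : Finset (Fin (2 * r))} (hS : S.card ≤ r) :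
    (S.image Sum.inl ∪ {Sum.inr 0, Sum.inr 1} : Finset (Fin (2 * r) ⊕ Fin 2)).card ≤ r + 2 :=
  (Finset.card_union_le _ _).trans
    (Nat.add_le_add (Finset.card_image_le.trans hS) Finset.card_le_two)

theorem card_filter_val_lt_half (r : ℕ) :
    (Finset.univ.filter fun i : Fin (2 * r) => (i : ℕ) < r).card = r := by
  rw [Fin.card_filter_val_lt]
  omega

theorem card_filter_half_le_val (r : ℕ) :
    (Finset.univ.filter fun i : Fin (2 * r) => r ≤ (i : ℕ)).card = r := by
  have h := Finset.card_filter_add_card_filter_not (s := Finset.univ)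
    (fun i : Fin (2 * r) => (i : ℕ) < r)
  simp only [not_lt, card_filter_val_lt_half, Finset.card_univ, Fintype.card_fin] at h
  omega

/-- For `r ≥ 2`, a set `A` of `r + 2` vertices of `H_r` is `(r+1)`-independent iff it is
`{v₁, …, v_r, x₁, x₂}` or `{v_{r+1}, …, v_{2r}, x₁, x₂}`; in particular `Ind_{r+1}(H_r)`
has exactly two faces of cardinality `r + 2`. -/
theorem Hr_faces_of_card_r_add_two (r : ℕ) (hr : 2 ≤ r)
    (A : Finset (Fin (2 * r) ⊕ Fin 2)) (hA : A.card = r + 2) :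
    rIndep (Hr r) (r + 1) ↑A ↔
      A = (Finset.univ.filter fun i : Fin (2 * r) => (i : ℕ) < r).image Sum.inl ∪
            {Sum.inr 0, Sum.inr 1} ∨
      A = (Finset.univ.filter fun i : Fin (2 * r) => r ≤ (i : ℕ)).image Sum.inl ∪
            {Sum.inr 0, Sum.inr 1} := by
  rw [rIndep_iff_not_preconnected _ hA]
  constructor
  · intro hconn
    obtain ⟨i, hi⟩ : ∃ i, Sum.inl i ∈ A := by
      by_contra! hno
      have hsub : A ⊆ {Sum.inr 0, Sum.inr 1} := by
        rintro (i | x) ha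
        · exact absurd ha (hno i)
        · fin_cases x <;> simp
      have := (Finset.card_le_card hsub).trans Finset.card_le_two
      omega
    obtain ⟨x, hx⟩ : ∃ x, ∀ j, Sum.inl j ∈ A → ¬ (Hr r).Adj (Sum.inr x) (Sum.inl j) := by
      by_contra! hno
      exact hconn (Hr_induce_preconnected hi fun x _ => hno x)
    fin_cases x
    · right
      refine Finset.eq_of_subset_of_card_le ?_
        (hA ▸ card_image_inl_union_pair_le (card_filter_half_le_val r).le)
      rintro (j | y) ha
      · simpa using hx j ha
      · fin_cases y <;> simp
    · left
      refine Finset.eq_of_subset_of_card_le ?_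
        (hA ▸ card_image_inl_union_pair_le (card_filter_val_lt_half r).le)
      rintro (j | y) ha
      · simpa using hx j ha
      · fin_cases y <;> simp
  · rintro (rfl | rfl)
    · refine not_preconnected_induce_of_isolated _ (x := Sum.inr 1) (y := Sum.inr 0)
        (by simp) (by simp) (by simp) ?_
      rintro (j | y) ha
      · simpa using ha
      · exact not_Hr_adj_inr_inr 1 y
    · refine not_preconnected_induce_of_isolated _ (x := Sum.inr 0) (y := Sum.inr 1)
        (by simp) (by simp) (by simp) ?_
      rintro (j | y) ha
      · simpa using ha
      · exact not_Hr_adj_inr_inr 0 y
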